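/- arXiv:2510.15344 — 5 statements merged into one kernel-verified Lean document; each statement's English description precedes it below -/
import Mathlib

section
/- Suppose the local upward incentive compatibility (LUIC) constraints hold for all adjacent pairs, i.e., θ_k·R_k − C_k ≥ θ_k·R_{k+1} − C_{k+1} for all k ∈ {1,…,K−1}, and rewards are nondecreasing (R_k ≤ R_{k+1} for all k ≤ K−1). Then the global upward incentive compatibility constraints hold: θ_k·R_k − C_k ≥ θ_k·R_j − C_j for all pairs with k ≤ j. -/
/-- Adjacent local upward incentive compatibility (LUIC) together with
nondecreasing rewards implies global upward incentive compatibility. -/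
theorem luic_implies_global_upward_ic
    (K : ℕ) (hK : 1 ≤ K) (θ R C : ℕ → ℝ)
    (hθpos : 0 < θ 1)
    (hθmono : ∀ k, 1 ≤ k → k < K → θ k < θ (k + 1))
    (hLUIC : ∀ k, 1 ≤ k → k < K →
      θ k * R k - C k ≥ θ k * R (k + 1) - C (k + 1))
    (hRmono : ∀ k, 1 ≤ k → k < K → R k ≤ R (k + 1)) :
    ∀ k j, 1 ≤ k → k ≤ j → j ≤ K →
      θ k * R k - C k ≥ θ k * R j - C j := by
  intro k j hk hkj
  have hθ : ∀ i, k ≤ i → i ≤ K → θ k ≤ θ i := by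
    intro i hki
    induction i, hki using Nat.le_induction with
    | base => exact fun _ => le_rfl
    | succ i hki ih =>
      exact fun hi => (ih (by omega)).trans (hθmono i (by omega) (by omega)).le
  induction j, hkj using Nat.le_induction with
  | base => exact fun _ => le_rfl
  | succ j hkj ih =>
    intro hj
    have hstep := hLUIC j (by omega) (by omega)
    have hgain := mul_le_mul_of_nonneg_right (hθ j hkj (by omega))
      (sub_nonneg.2 (hRmono j (by omega) (by omega)))
    linarith [ih (by omega)]
end

section
/- Suppose the adjacent downward incentive constraints hold with equality (binding LDIC): θ_{k+1}·(R_{k+1} − R_k) = C_{k+1} − C_k for all k ∈ {1,…,K−1}, and rewards are nondecreasing (R_k ≤ R_{k+1}). Then the adjacent local upward incentive compatibility constraints hold automatically: θ_k·R_k − C_k ≥ θ_k·R_{k+1} − C_{k+1} for all k ∈ {1,…,K−1}. -/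
/-- If the adjacent downward incentive constraints bind,
`θ (k+1) * (R (k+1) - R k) = C (k+1) - C k`, and rewards are nondecreasing, then the
adjacent local upward incentive compatibility constraints hold automatically. -/
theorem binding_ldic_implies_luic
    (K : ℕ) (hK : 1 ≤ K) (θ R C : ℕ → ℝ)
    (hθpos : 0 < θ 1)
    (hθmono : ∀ k, 1 ≤ k → k < K → θ k < θ (k + 1))
    (hbind : ∀ k, 1 ≤ k → k < K →
      θ (k + 1) * (R (k + 1) - R k) = C (k + 1) - C k)
    (hRmono : ∀ k, 1 ≤ k → k < K → R k ≤ R (k + 1)) :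
    ∀ k, 1 ≤ k → k < K →
      θ k * R k - C k ≥ θ k * R (k + 1) - C (k + 1) := by
  intro k h1 hk
  have hprod : 0 ≤ (θ (k + 1) - θ k) * (R (k + 1) - R k) :=
    mul_nonneg (sub_nonneg.mpr (hθmono k h1 hk).le) (sub_nonneg.mpr (hRmono k h1 hk))
  linarith [hbind k h1 hk]
end

section
/- Let the rewards be defined by the closed form R_k = C_1/θ_1 + Σ_{i=2}^{k} (C_i − C_{i−1})/θ_i, where the costs are nonnegative and nondecreasing (0 ≤ C_1 ≤ C_2 ≤ … ≤ C_K). Then every type's individual-rationality constraint is satisfied: θ_k·R_k − C_k ≥ 0 for all k ∈ {1,…,K}. -/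
/-- With rewards given by the closed form
`R k = C 1 / θ 1 + ∑_{i=2}^{k} (C i - C (i-1)) / θ i` and costs nonnegative and
nondecreasing, every type's individual-rationality constraint holds. -/
theorem closed_form_reward_satisfies_ir
    (K : ℕ) (hK : 1 ≤ K) (θ R C : ℕ → ℝ)
    (hθpos : 0 < θ 1)
    (hθmono : ∀ k, 1 ≤ k → k < K → θ k < θ (k + 1))
    (hC1 : 0 ≤ C 1)
    (hCmono : ∀ k, 1 ≤ k → k < K → C k ≤ C (k + 1))
    (hR : ∀ k, 1 ≤ k → k ≤ K →
      R k = C 1 / θ 1 + ∑ i ∈ Finset.Icc 2 k, (C i - C (i - 1)) / θ i) :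
    ∀ k, 1 ≤ k → k ≤ K → θ k * R k - C k ≥ 0 := by
  have key : ∀ k, 1 ≤ k → k ≤ K → 0 < θ k ∧ 0 ≤ C k ∧
      C k ≤ θ k * (C 1 / θ 1 + ∑ i ∈ Finset.Icc 2 k, (C i - C (i - 1)) / θ i) := by
    intro k hk
    induction k, hk using Nat.le_induction with
    | base =>
      intro _
      refine ⟨hθpos, hC1, ?_⟩
      simp [mul_div_cancel₀ _ hθpos.ne']
    | succ n hn ih =>
      intro hnK
      obtain ⟨hθn, hCn, hIR⟩ := ih (by omega)
      have hθ := hθmono n hn (by omega)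
      have hC := hCmono n hn (by omega)
      have hθ' := hθn.trans hθ
      refine ⟨hθ', hCn.trans hC, ?_⟩
      rw [Finset.sum_Icc_succ_top (by omega), Nat.add_sub_cancel, ← add_assoc, mul_add,
        mul_div_cancel₀ _ hθ'.ne']
      have hS := nonneg_of_mul_nonneg_right (hCn.trans hIR) hθn
      linarith [mul_le_mul_of_nonneg_right hθ.le hS]
  intro k hk hkK
  rw [hR k hk hkK]
  exact sub_nonneg.mpr (key k hk hkK).2.2
end

section
/- Let the rewards be defined by the closed form R_k = C_1/θ_1 + Σ_{i=2}^{k} (C_i − C_{i−1})/θ_i, where the costs are nondecreasing (C_1 ≤ C_2 ≤ … ≤ C_K). Then the resulting contract menu is fully incentive compatible: θ_k·R_k − C_k ≥ θ_k·R_j − C_j for all pairs of types k, j ∈ {1,…,K}. -/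
/-- A function on `ℕ` that does not decrease at any step between `a` and `b` satisfies
`f a ≤ f b`. -/
theorem le_of_forall_step_le {f : ℕ → ℝ} {a b : ℕ} (hab : a ≤ b)
    (h : ∀ i, a ≤ i → i < b → f i ≤ f (i + 1)) : f a ≤ f b := by
  induction b, hab using Nat.le_induction with
  | base => exact le_rfl
  | succ n hn ih =>
    exact (ih fun i hi hin => h i hi (by omega)).trans (h n hn (by omega))

/-- With rewards given by the closed form
`R k = C 1 / θ 1 + ∑_{i=2}^{k} (C i - C (i-1)) / θ i` and nondecreasing costs, the
resulting contract menu is fully incentive compatible. -/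
theorem closed_form_reward_is_incentive_compatible
    (K : ℕ) (hK : 1 ≤ K) (θ R C : ℕ → ℝ)
    (hθpos : 0 < θ 1)
    (hθmono : ∀ k, 1 ≤ k → k < K → θ k < θ (k + 1))
    (hCmono : ∀ k, 1 ≤ k → k < K → C k ≤ C (k + 1))
    (hR : ∀ k, 1 ≤ k → k ≤ K →
      R k = C 1 / θ 1 + ∑ i ∈ Finset.Icc 2 k, (C i - C (i - 1)) / θ i) :
    ∀ k j, 1 ≤ k → k ≤ K → 1 ≤ j → j ≤ K →
      θ k * R k - C k ≥ θ k * R j - C j := by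
  have hθle : ∀ a b, 1 ≤ a → a ≤ b → b ≤ K → θ a ≤ θ b := fun a b ha hab hb =>
    le_of_forall_step_le hab fun i hi hib => (hθmono i (by omega) (by omega)).le
  have hstep : ∀ i, 1 ≤ i → i < K →
      R i ≤ R (i + 1) ∧ θ (i + 1) * (R (i + 1) - R i) = C (i + 1) - C i := by
    intro i hi hiK
    have hpos : 0 < θ (i + 1) := hθpos.trans_le (hθle 1 (i + 1) le_rfl (by omega) hiK)
    have hdiff : R (i + 1) = R i + (C (i + 1) - C i) / θ (i + 1) := by
      rw [hR (i + 1) (by omega) hiK, hR i hi hiK.le,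
        Finset.sum_Icc_succ_top (by omega), Nat.add_sub_cancel, add_assoc]
    refine ⟨?_, ?_⟩
    · rw [hdiff]
      exact le_add_of_nonneg_right (div_nonneg (sub_nonneg.2 (hCmono i hi hiK)) hpos.le)
    · rw [hdiff, add_sub_cancel_left, mul_div_cancel₀ _ hpos.ne']
  intro k j hk hkK hj hjK
  rcases le_total j k with hjk | hkj
  · refine le_of_forall_step_le (f := fun i => θ k * R i - C i) hjk fun i hi hik => ?_
    obtain ⟨hRi, hCi⟩ := hstep i (by omega) (by omega)
    have hθi := hθle (i + 1) k (by omega) hik hkK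
    have := mul_le_mul_of_nonneg_right hθi (sub_nonneg.2 hRi)
    linarith
  · refine neg_le_neg_iff.1 <|
      le_of_forall_step_le (f := fun i => -(θ k * R i - C i)) hkj fun i hi hij => ?_
    obtain ⟨hRi, hCi⟩ := hstep i (by omega) (by omega)
    have hθi := hθle k (i + 1) hk (by omega) (by omega)
    have := mul_le_mul_of_nonneg_right hθi (sub_nonneg.2 hRi)
    linarith
end

section
/- (IR binding at the optimum) Suppose ρ_k > 0 for all k, C_1 ≥ 0, the contract menu (R, C) satisfies the type-1 individual-rationality constraint θ_1·R_1 − C_1 ≥ 0 and the adjacent local downward incentive compatibility constraints θ_k·R_k − C_k ≥ θ_k·R_{k−1} − C_{k−1} for k ∈ {2,…,K}, and θ_1·R_1 > C_1 (type-1 IR is slack). Then the modified menu R′ with R′_1 = C_1/θ_1 and R′_k = R_k for k ≥ 2 still satisfies the type-1 IR constraint (with equality) and all adjacent LDIC constraints, and it yields strictly lower total expected payment: Σ_{k=1}^{K} ρ_k·θ_k·R′_k < Σ_{k=1}^{K} ρ_k·θ_k·R_k. Hence any menu maximizing the data consumer's utility (which is strictly decreasing in total expected payment) has θ_1·R_1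 = C_1. -/
/-- IR binding at the optimum: If all type probabilities are positive,
`C 1 ≥ 0`, the menu satisfies type-1 IR and the adjacent LDIC constraints, and the
type-1 IR constraint is slack (`θ 1 * R 1 > C 1`), then the modified menu `R'` with
`R' 1 = C 1 / θ 1` and `R' k = R k` for `k ≥ 2` still satisfies type-1 IR with
equality and all adjacent LDIC constraints, yet yields strictly lower total expected
payment; hence (data-consumer utility being strictly decreasing in total expected
payment) `R` cannot maximize the data consumer's utility over menus satisfying
type-1 IR and adjacent LDIC. -/
theorem slack_ir_is_suboptimal
    (K : ℕ) (hK : 1 ≤ K) (θ R C ρ : ℕ → ℝ)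
    (hθpos : 0 < θ 1)
    (hθmono : ∀ k, 1 ≤ k → k < K → θ k < θ (k + 1))
    (hρpos : ∀ k, 1 ≤ k → k ≤ K → 0 < ρ k)
    (hC1 : 0 ≤ C 1)
    (hIR1 : θ 1 * R 1 - C 1 ≥ 0)
    (hLDIC : ∀ k, 1 ≤ k → k < K →
      θ (k + 1) * R (k + 1) - C (k + 1) ≥ θ (k + 1) * R k - C k)
    (hslack : θ 1 * R 1 > C 1)
    (R' : ℕ → ℝ)
    (hR' : R' 1 = C 1 / θ 1 ∧ ∀ k, 2 ≤ k → R' k = R k) :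
    (θ 1 * R' 1 - C 1 = 0) ∧
    (∀ k, 1 ≤ k → k < K →
      θ (k + 1) * R' (k + 1) - C (k + 1) ≥ θ (k + 1) * R' k - C k) ∧
    (∑ k ∈ Finset.Icc 1 K, ρ k * θ k * R' k <
      ∑ k ∈ Finset.Icc 1 K, ρ k * θ k * R k) ∧
    (∀ u : ℝ → ℝ, StrictAnti u →
      ¬ (∀ R'' : ℕ → ℝ, θ 1 * R'' 1 - C 1 ≥ 0 →
          (∀ k, 1 ≤ k → k < K →
            θ (k + 1) * R'' (k + 1) - C (k + 1) ≥ θ (k + 1) * R'' k - C k) →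
          u (∑ k ∈ Finset.Icc 1 K, ρ k * θ k * R'' k) ≤
            u (∑ k ∈ Finset.Icc 1 K, ρ k * θ k * R k))) := by
  obtain ⟨h1, h2⟩ := hR'
  have hbind : θ 1 * R' 1 = C 1 := by rw [h1]; field_simp
  have hlt : R' 1 < R 1 := lt_of_mul_lt_mul_left (hbind.trans_lt hslack) hθpos.le
  have hIC : ∀ k, 1 ≤ k → k < K →
      θ (k + 1) * R' (k + 1) - C (k + 1) ≥ θ (k + 1) * R' k - C k := by
    intro k hk hkK
    have hIC_R := hLDIC k hk hkK
    rw [h2 (k + 1) (by omega)]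
    rcases hk.eq_or_lt with rfl | hk2
    · have hθ2 : 0 < θ (1 + 1) := hθpos.trans (hθmono 1 le_rfl hkK)
      have := mul_lt_mul_of_pos_left hlt hθ2
      linarith
    · rwa [h2 k hk2]
  have hpay : ∑ k ∈ Finset.Icc 1 K, ρ k * θ k * R' k <
      ∑ k ∈ Finset.Icc 1 K, ρ k * θ k * R k := by
    have h1lt : ρ 1 * θ 1 * R' 1 < ρ 1 * θ 1 * R 1 :=
      mul_lt_mul_of_pos_left hlt (mul_pos (hρpos 1 le_rfl hK) hθpos)
    refine Finset.sum_lt_sum (fun k hk => ?_) ⟨1, Finset.mem_Icc.2 ⟨le_rfl, hK⟩, h1lt⟩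
    rcases (Finset.mem_Icc.1 hk).1.eq_or_lt with rfl | hk2
    · exact h1lt.le
    · rw [h2 k hk2]
  exact ⟨sub_eq_zero.2 hbind, hIC, hpay, fun u hu hmax =>
    (hu hpay).not_ge (hmax R' (sub_eq_zero.2 hbind).ge hIC)⟩
end
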